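/- Every finite point set S ⊂ ℝ² in general position with |S| ≥ 2 admits a plane spanning path that is 5π/4-open: every vertex has an incident angle of at least 5π/4 (equivalently, at every interior vertex of the path the smaller angle between its two edges is at most 3π/4). -/

import Mathlib

open scoped Classical
open EuclideanGeometry

noncomputable section

abbrev Pt := EuclideanSpace ℝ (Fin 2)

/-- No three points of `S` are collinear. -/
def GenPos (S : Finset Pt) : Prop :=
  ∀ p ∈ S, ∀ q ∈ S, ∀ r ∈ S, p ≠ q → p ≠ r → q ≠ r →
    ¬ Collinear ℝ ({p, q, r} : Set Pt)

/-- A plane straight-line graph on the finite point set `S`: vertices are points of `S`,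
edges are recorded as ordered pairs closed under swapping, and two edges that are not
the same unordered pair may only meet at common endpoints. -/
structure PSLG (S : Finset Pt) where
  E : Finset (Pt × Pt)
  symm : ∀ e ∈ E, (e.2, e.1) ∈ E
  endpts : ∀ e ∈ E, e.1 ∈ S ∧ e.2 ∈ S
  ne : ∀ e ∈ E, e.1 ≠ e.2
  noncross : ∀ e ∈ E, ∀ f ∈ E, e ≠ f → e ≠ (f.2, f.1) →
    ∀ x, x ∈ segment ℝ e.1 e.2 → x ∈ segment ℝ f.1 f.2 →
      (x = e.1 ∨ x = e.2) ∧ (x = f.1 ∨ x = f.2)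

/-- The degree of the point `p` in `G`. -/
def PSLG.deg {S : Finset Pt} (G : PSLG S) (p : Pt) : ℕ :=
  (G.E.filter fun e => e.1 = p).card

/-- The point `p` has an incident angle of size at least `φ` in `G`: all edge directions
at `p` fit in a closed cone of half-angle `π - φ / 2` (for `p` of degree ≤ 1 the maximum
incident angle is `2π`, and this condition holds trivially). -/
def VertexOpen {S : Finset Pt} (G : PSLG S) (p : Pt) (φ : ℝ) : Prop :=
  ∃ d : Pt, d ≠ 0 ∧ ∀ q : Pt, (p, q) ∈ G.E →
    InnerProductGeometry.angle d (q - p) ≤ Real.pi - φ / 2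

/-- `G` is `φ`-open: every vertex has an incident angle of size at least `φ`. -/
def PSLG.IsPhiOpen {S : Finset Pt} (G : PSLG S) (φ : ℝ) : Prop :=
  ∀ p ∈ S, VertexOpen G p φ

/-- `G` is connected on `S`. -/
def PSLG.Connected {S : Finset Pt} (G : PSLG S) : Prop :=
  ∀ p ∈ S, ∀ q ∈ S, Relation.ReflTransGen (fun a b => (a, b) ∈ G.E) p q

/-- `G` is a spanning tree of `S`: connected and with the minimum possible number of
edges (each undirected edge is recorded twice). -/
def PSLG.IsSpanningTree {S : Finset Pt} (G : PSLG S) : Prop :=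
  G.Connected ∧ G.E.card = 2 * (S.card - 1)

/-- `G` is a (non-crossing Hamiltonian) spanning path of `S`: a spanning tree of maximum
vertex degree at most two. -/
def PSLG.IsSpanningPath {S : Finset Pt} (G : PSLG S) : Prop :=
  G.IsSpanningTree ∧ ∀ p ∈ S, G.deg p ≤ 2

/-- `S` is in convex position. -/
def ConvexPos (S : Finset Pt) : Prop :=
  ∀ p ∈ S, p ∉ convexHull ℝ (↑(S.erase p) : Set Pt)

/-- `G` is a triangulation of `S`: a maximal plane straight-line graph, i.e. any further
edge between points of `S` would cross the existing graph. -/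
def PSLG.IsTriangulation {S : Finset Pt} (G : PSLG S) : Prop :=
  ∀ p ∈ S, ∀ q ∈ S, p ≠ q → (p, q) ∉ G.E →
    ∃ e ∈ G.E, ∃ x, x ∈ segment ℝ p q ∧ x ∈ segment ℝ e.1 e.2 ∧
      ¬((x = p ∨ x = q) ∧ (x = e.1 ∨ x = e.2))

end

/-- Twice the signed area of the triangle `p a b`. -/
def cr (p a b : Pt) : ℝ := (a 0 - p 0) * (b 1 - p 1) - (a 1 - p 1) * (b 0 - p 0)

/-- The inner product of `a - p` and `b - p`. -/
def dt (p a b : Pt) : ℝ := (a 0 - p 0) * (b 0 - p 0) + (a 1 - p 1) * (b 1 - p 1)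

/-- The angle `∠ a p b` is at most `3π/4`, in polynomial form. -/
def Ok (a p b : Pt) : Prop := 0 ≤ dt p a b + |cr p a b|

/-- A linear form with coefficients `a`, `b`, measured from the point `v`. -/
def lf (a b : ℝ) (v t : Pt) : ℝ := a * (t 0 - v 0) + b * (t 1 - v 1)

/-- `v` lies on a supporting line of `T`. -/
def OnHull (v : Pt) (T : Finset Pt) : Prop :=
  ∃ a b : ℝ, (a ≠ 0 ∨ b ≠ 0) ∧ ∀ t ∈ T, 0 ≤ lf a b v t

/-- The segment from `q` to `v` is separated from the hull of `T`, except at `v`. -/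
def Vis (q v : Pt) (T : Finset Pt) : Prop :=
  ∃ a b : ℝ, (a ≠ 0 ∨ b ≠ 0) ∧ lf a b v q ≤ 0 ∧
    ∀ t ∈ T, 0 ≤ lf a b v t ∧ (t = v ∨ lf a b v q < lf a b v t)

/-- No three points of `S` have vanishing orientation. -/
def NoColl (S : Finset Pt) : Prop :=
  ∀ p ∈ S, ∀ q ∈ S, ∀ r ∈ S, p ≠ q → p ≠ r → q ≠ r → cr p q r ≠ 0

/-- `p s` is an edge of the convex hull of `T`, with `T` to its left. -/
def HullEdge (T : Finset Pt) (p s : Pt) : Prop :=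
  p ∈ T ∧ s ∈ T ∧ p ≠ s ∧ ∀ t ∈ T, t ≠ p → t ≠ s → 0 < cr p s t

/-- `OpenPath S q r`: there is an open plane spanning path of `S` that starts with `q, r`. -/
inductive OpenPath : Finset Pt → Pt → Pt → Prop
  | two (q v : Pt) : q ≠ v → OpenPath {q, v} q v
  | cons (T : Finset Pt) (q v w : Pt) : q ∉ T → OpenPath T v w → Vis q v T → Ok q v w →
      OpenPath (insert q T) q v

lemma cr_cyc (p a b : Pt) : cr p a b = cr a b p := by unfold cr; ring

lemma cr_swap (p a b : Pt) : cr p b a = -cr p a b := by unfold cr; ring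

lemma cr_right_eq (p a : Pt) : cr p a a = 0 := by unfold cr; ring

lemma cr_outer_eq (p a : Pt) : cr p a p = 0 := by unfold cr; ring

lemma dt_comm (p a b : Pt) : dt p b a = dt p a b := by unfold dt; ring

lemma Ok.symm {a p b : Pt} (h : Ok a p b) : Ok b p a := by
  unfold Ok at *
  rwa [dt_comm, cr_swap, abs_neg]

lemma ok_of_dt {a p b : Pt} (h : 0 ≤ dt p a b) : Ok a p b :=
  add_nonneg h (abs_nonneg _)

lemma not_ok_of_pos {a p b : Pt} (h : ¬ Ok a p b) (hc : 0 ≤ cr p a b) :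
    dt p a b + cr p a b < 0 := by
  unfold Ok at h
  rwa [abs_of_nonneg hc, not_le] at h

lemma cr_plucker (p s l t x : Pt) :
    cr p s l * cr p x t = cr p t l * cr p x s + cr p s t * cr p x l := by
  unfold cr; ring

lemma dt_plucker (p s l t x : Pt) :
    cr p s l * dt p x t = cr p t l * dt p x s + cr p s t * dt p x l := by
  unfold cr dt; ring

lemma lf_plucker (a b : ℝ) (p s l t : Pt) :
    cr p s l * lf a b p t = cr p t l * lf a b p s + cr p s t * lf a b p l := by
  unfold cr lf; ring

lemma dt_mul (p q s t : Pt) :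
    dt p q q * dt p s t = dt p q s * dt p q t + cr p q s * cr p q t := by
  unfold cr dt; ring

lemma cr_mul (p q s t : Pt) :
    dt p q q * cr p s t = dt p q s * cr p q t - cr p q s * dt p q t := by
  unfold cr dt; ring

lemma dt_self_nonneg (p q : Pt) : 0 ≤ dt p q q := by
  unfold dt; nlinarith [sq_nonneg (q 0 - p 0), sq_nonneg (q 1 - p 1)]

lemma dt_self_pos {p q s : Pt} (h : cr p q s ≠ 0) : 0 < dt p q q := by
  rcases (dt_self_nonneg p q).lt_or_eq with h1 | h1
  · exact h1
  · exfalso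
    apply h
    have h2 : (q 0 - p 0) = 0 := by
      unfold dt at h1; nlinarith [sq_nonneg (q 0 - p 0), sq_nonneg (q 1 - p 1)]
    have h3 : (q 1 - p 1) = 0 := by
      unfold dt at h1; nlinarith [sq_nonneg (q 0 - p 0), sq_nonneg (q 1 - p 1)]
    unfold cr; rw [h2, h3]; ring

/-- A cone on the far side of a wide angle, on one side of the line `p q`, is acute. -/
lemma dt_nonneg_of_wide {p q s l : Pt} (h1 : 0 < cr p q s) (h2 : 0 < cr p q l)
    (h3 : 0 ≤ cr p s l) (hb : dt p q s + cr p q s < 0) : 0 ≤ dt p s l := by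
  have hn := dt_self_pos h1.ne'
  have e1 := dt_mul p q s l
  have e2 := cr_mul p q s l
  have h4 : 0 ≤ dt p q q * cr p s l := by positivity
  have h5 : dt p q s < 0 := by linarith
  have h6 : dt p q l < 0 := by
    by_contra h
    push Not at h
    nlinarith [mul_nonneg h1.le h, mul_pos (neg_pos.2 h5) h2]
  have h7 : 0 ≤ dt p q q * dt p s l := by
    nlinarith [mul_pos (neg_pos.2 h5) (neg_pos.2 h6), mul_pos h1 h2]
  exact nonneg_of_mul_nonneg_right h7 hn

lemma dt_nonneg_of_wide' {p q s l : Pt} (h1 : 0 < cr p l q) (h2 : 0 < cr p s q)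
    (h3 : 0 ≤ cr p s l) (hb : dt p q l + cr p l q < 0) : 0 ≤ dt p s l := by
  have e1 := dt_mul p q l s
  have e2 := cr_mul p q l s
  rw [cr_swap p l q, cr_swap p s q] at e1
  rw [cr_swap p l q, cr_swap p s q, cr_swap p s l] at e2
  have hn : 0 < dt p q q := dt_self_pos (s := l) (by rw [cr_swap]; linarith [h1.ne'])
  have h4 : 0 ≤ dt p q q * cr p s l := by positivity
  have h5 : dt p q l < 0 := by linarith
  have h6 : dt p q s < 0 := by
    by_contra h
    push Not at h
    nlinarith [mul_nonneg h1.le h, mul_pos (neg_pos.2 h5) h2]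
  have h7 : 0 ≤ dt p q q * dt p l s := by
    nlinarith [mul_pos (neg_pos.2 h5) (neg_pos.2 h6), mul_pos h1 h2]
  rw [dt_comm]
  exact nonneg_of_mul_nonneg_right h7 hn

/-- Two wide angles around `p`, on either side of `p q`, leave an acute angle. -/
lemma dt_pos_of_wide_wide {p q s l : Pt} (h1 : 0 < cr p q s) (h2 : 0 < cr p l q)
    (hb : dt p q s + cr p q s < 0) (hc : dt p q l + cr p l q < 0) : 0 < dt p s l := by
  have hn := dt_self_pos h1.ne'
  have e1 := dt_mul p q s l
  rw [cr_swap p l q] at e1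
  have h5 : cr p q s < - dt p q s := by linarith
  have h6 : cr p l q < - dt p q l := by linarith
  have h7 : 0 < dt p q q * dt p s l := by
    nlinarith [mul_lt_mul'' h5 h6 h1.le h2.le]
  exact pos_of_mul_pos_right h7 hn.le

/-- Every ray from `u` makes an angle at most `3π/4` with one of two rays spanning an angle of
at least `π/2`. -/
lemma ok_or_ok {u a b w : Pt} (h : dt u a b ≤ 0) : Ok a u w ∨ Ok b u w := by
  by_contra hc
  push Not at hc
  obtain ⟨h1, h2⟩ := hc
  unfold Ok at h1 h2
  rw [not_le] at h1 h2
  have e := dt_mul u w a b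
  rw [dt_comm u a w, dt_comm u b w, cr_swap u a w, cr_swap u b w] at e
  have h3 : |cr u a w| < - dt u a w := by linarith
  have h4 : |cr u b w| < - dt u b w := by linarith
  have h5 := mul_lt_mul'' h3 h4 (abs_nonneg _) (abs_nonneg _)
  rw [← abs_mul] at h5
  have h6 := neg_abs_le (cr u a w * cr u b w)
  nlinarith [mul_nonneg (dt_self_nonneg u w) (neg_nonneg.2 h)]

lemma ok_cone {p s l t : Pt} (hsl : 0 < cr p s l) (hok : Ok s p l) (h1 : 0 ≤ cr p s t)
    (h2 : 0 ≤ cr p t l) : Ok s p t ∧ Ok l p t := by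
  unfold Ok at hok
  rw [abs_of_pos hsl] at hok
  constructor
  · unfold Ok
    rw [abs_of_nonneg h1]
    have e := dt_plucker p s l t s
    have : 0 ≤ cr p s l * (dt p s t + cr p s t) := by
      nlinarith [mul_nonneg h2 (dt_self_nonneg p s), mul_nonneg h1 hok]
    exact nonneg_of_mul_nonneg_right this hsl
  · unfold Ok
    rw [cr_swap, abs_neg, abs_of_nonneg h2]
    have e := dt_plucker p s l t l
    rw [dt_comm p s l] at e
    have : 0 ≤ cr p s l * (dt p l t + cr p t l) := by
      nlinarith [mul_nonneg h1 (dt_self_nonneg p l), mul_nonneg h2 hok]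
    exact nonneg_of_mul_nonneg_right this hsl

lemma NoColl.mono {S T : Finset Pt} (h : NoColl S) (hT : T ⊆ S) : NoColl T :=
  fun p hp q hq r hr => h p (hT hp) q (hT hq) r (hT hr)

lemma HullEdge.nonneg {T : Finset Pt} {p s : Pt} (h : HullEdge T p s) {t : Pt} (ht : t ∈ T) :
    0 ≤ cr p s t := by
  by_cases h1 : t = p
  · rw [h1, cr_outer_eq]
  by_cases h2 : t = s
  · rw [h2, cr_right_eq]
  exact (h.2.2.2 t ht h1 h2).le

lemma exists_extremal_direction {S : Finset Pt} (hS : NoColl S) {p : Pt} (hp : p ∈ S)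
    (he : OnHull p S) (h2 : 2 ≤ S.card) {ε : ℝ} (hε : ε ≠ 0) :
    ∃ s ∈ S, s ≠ p ∧ ∀ t ∈ S, t ≠ p → t ≠ s → 0 < ε * cr p s t := by
  obtain ⟨a, b, hab, hf⟩ := he
  have key : ∀ R : Finset Pt, R.Nonempty → R ⊆ S.erase p →
      ∃ s ∈ R, ∀ t ∈ R, t ≠ s → 0 < ε * cr p s t := by
    intro R hR
    induction hR using Finset.Nonempty.cons_induction with
    | singleton a =>
      intro _
      exact ⟨a, by simp, by simp⟩
    | cons t R ht hR ih =>
      intro hsub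
      obtain ⟨s, hs, hmin⟩ := ih (fun x hx => hsub (Finset.mem_cons_of_mem hx))
      have hmem : ∀ x ∈ Finset.cons t R ht, x ∈ S ∧ x ≠ p := fun x hx =>
        ⟨Finset.mem_of_mem_erase (hsub hx), Finset.ne_of_mem_erase (hsub hx)⟩
      obtain ⟨htS, htp⟩ := hmem t (Finset.mem_cons_self _ _)
      obtain ⟨hsS, hsp⟩ := hmem s (Finset.mem_cons_of_mem hs)
      have hts : t ≠ s := fun h => ht (h ▸ hs)
      rcases lt_or_gt_of_ne
        (mul_ne_zero hε (hS p hp s hsS t htS hsp.symm htp.symm hts.symm)) with h | h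
      · refine ⟨t, Finset.mem_cons_self _ _, fun r hr hrt => ?_⟩
        rw [Finset.mem_cons] at hr
        have hr := hr.resolve_left hrt
        have h' : 0 < ε * cr p t s := by rw [cr_swap]; linarith
        by_cases hrs : r = s
        · rwa [hrs]
        obtain ⟨hrS, hrp⟩ := hmem r (Finset.mem_cons_of_mem hr)
        have hsr := hmin r hr hrs
        by_contra hc
        have hne := hS p hp t htS r hrS htp.symm hrp.symm (Ne.symm hrt)
        have e := lf_plucker a b p t r s
        have w1 : 0 ≤ ε * cr p s r * lf a b p t := mul_nonneg hsr.le (hf t htS)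
        have w2 : 0 ≤ ε * cr p t s * lf a b p r := mul_nonneg h'.le (hf r hrS)
        have w3 : 0 ≤ -(ε * cr p t r) * lf a b p s := mul_nonneg (by linarith) (hf s hsS)
        have e' : -(-(ε * cr p t r) * lf a b p s) =
            ε * cr p s r * lf a b p t + ε * cr p t s * lf a b p r := by
          linear_combination ε * e
        have y1 : lf a b p t = 0 := by
          have : ε * cr p s r * lf a b p t = 0 := by linarith
          exact (mul_eq_zero.1 this).resolve_left hsr.ne'
        have y2 : lf a b p r = 0 := by
          have : ε * cr p t s * lf a b p r = 0 := by linarith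
          exact (mul_eq_zero.1 this).resolve_left h'.ne'
        unfold lf at y1 y2
        have k1 : a * cr p t r = 0 := by
          unfold cr; linear_combination (r 1 - p 1) * y1 - (t 1 - p 1) * y2
        have k2 : b * cr p t r = 0 := by
          unfold cr; linear_combination (t 0 - p 0) * y2 - (r 0 - p 0) * y1
        rcases hab with h0 | h0
        · exact (mul_ne_zero h0 hne) k1
        · exact (mul_ne_zero h0 hne) k2
      · refine ⟨s, Finset.mem_cons_of_mem hs, fun r hr hrs => ?_⟩
        rw [Finset.mem_cons] at hr
        rcases hr with rfl | hr
        · exact h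
        · exact hmin r hr hrs
  have hne : (S.erase p).Nonempty := by
    rw [← Finset.card_pos, Finset.card_erase_of_mem hp]; omega
  obtain ⟨s, hs, hmin⟩ := key _ hne (Finset.Subset.refl _)
  exact ⟨s, Finset.mem_of_mem_erase hs, Finset.ne_of_mem_erase hs,
    fun t ht htp hts => hmin t (Finset.mem_erase.2 ⟨htp, ht⟩) hts⟩

lemma exists_hullEdge_from {S : Finset Pt} (hS : NoColl S) {p : Pt} (hp : p ∈ S)
    (he : OnHull p S) (h2 : 2 ≤ S.card) : ∃ s, HullEdge S p s := by
  obtain ⟨s, hs, hsp, h⟩ := exists_extremal_direction hS hp he h2 one_ne_zero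
  exact ⟨s, hp, hs, hsp.symm, by simpa using h⟩

lemma exists_hullEdge_to {S : Finset Pt} (hS : NoColl S) {p : Pt} (hp : p ∈ S)
    (he : OnHull p S) (h2 : 2 ≤ S.card) : ∃ l, HullEdge S l p := by
  obtain ⟨l, hl, hlp, h⟩ :=
    exists_extremal_direction hS hp he h2 (neg_ne_zero.2 (one_ne_zero (α := ℝ)))
  refine ⟨l, hl, hp, hlp, fun t ht h1 h2 => ?_⟩
  have := h t ht h2 h1
  rw [cr_cyc]
  linarith [cr_swap p t l]

lemma lf_line (x y v t : Pt) : lf (-(y 1 - x 1)) (y 0 - x 0) v t = cr x y t - cr x y v := by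
  unfold lf cr; ring

lemma line_coeff_ne {x y : Pt} (h : x ≠ y) : -(y 1 - x 1) ≠ 0 ∨ y 0 - x 0 ≠ 0 := by
  by_contra hc
  push Not at hc
  apply h
  ext i
  fin_cases i
  · simp only [Fin.zero_eta]; linarith [hc.2]
  · simp only [Fin.mk_one]; linarith [hc.1]

lemma vis_of_line {x y q v : Pt} {T : Finset Pt} (hxy : x ≠ y) (hv : cr x y v = 0)
    (hq : cr x y q ≤ 0) (hT : ∀ t ∈ T, 0 ≤ cr x y t ∧ (t = v ∨ cr x y q < cr x y t)) :
    Vis q v T := by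
  refine ⟨_, _, line_coeff_ne hxy, ?_, fun t ht => ?_⟩
  · rw [lf_line, hv]; linarith
  · rw [lf_line, lf_line, hv, sub_zero, sub_zero]
    exact hT t ht

lemma Vis.onHull {q v : Pt} {T : Finset Pt} (h : Vis q v T) : OnHull v T := by
  obtain ⟨a, b, hab, -, hT⟩ := h
  exact ⟨a, b, hab, fun t ht => (hT t ht).1⟩

lemma HullEdge.vis_left {T : Finset Pt} {a b q : Pt} (h : HullEdge T a b) (hq : cr a b q < 0) :
    Vis q a T :=
  vis_of_line h.2.2.1 (cr_outer_eq _ _) hq.le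
    fun _ ht => ⟨h.nonneg ht, Or.inr (hq.trans_le (h.nonneg ht))⟩

lemma HullEdge.vis_right {T : Finset Pt} {a b q : Pt} (h : HullEdge T a b) (hq : cr a b q < 0) :
    Vis q b T :=
  vis_of_line h.2.2.1 (cr_right_eq _ _) hq.le
    fun _ ht => ⟨h.nonneg ht, Or.inr (hq.trans_le (h.nonneg ht))⟩

lemma HullEdge.vis_erase_left {T : Finset Pt} {a b : Pt} (h : HullEdge T a b) :
    Vis a b (T.erase a) := by
  refine vis_of_line h.2.2.1 (cr_right_eq _ _) (cr_outer_eq _ _).le fun t ht => ?_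
  obtain ⟨hta, ht⟩ := Finset.mem_erase.1 ht
  refine ⟨h.nonneg ht, or_iff_not_imp_left.2 fun htb => ?_⟩
  rw [cr_outer_eq]
  exact h.2.2.2 t ht hta htb

lemma HullEdge.vis_erase_right {T : Finset Pt} {a b : Pt} (h : HullEdge T a b) :
    Vis b a (T.erase b) := by
  refine vis_of_line h.2.2.1 (cr_outer_eq _ _) (cr_right_eq _ _).le fun t ht => ?_
  obtain ⟨htb, ht⟩ := Finset.mem_erase.1 ht
  refine ⟨h.nonneg ht, or_iff_not_imp_left.2 fun hta => ?_⟩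
  rw [cr_right_eq]
  exact h.2.2.2 t ht hta htb

lemma OpenPath.mem_ne {S : Finset Pt} {q r : Pt} (h : OpenPath S q r) :
    q ∈ S ∧ r ∈ S ∧ q ≠ r := by
  induction h with
  | two q v hqv => exact ⟨by simp, by simp, hqv⟩
  | cons T q v w hq _ _ _ ih =>
    exact ⟨by simp, by simp [ih.1], fun h => hq (h ▸ ih.1)⟩

lemma OpenPath.cons_erase {S : Finset Pt} {q v w : Pt} (hq : q ∈ S)
    (h : OpenPath (S.erase q) v w) (hv : Vis q v (S.erase q)) (ho : Ok q v w) :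
    OpenPath S q v := by
  have := OpenPath.cons (S.erase q) q v w (Finset.notMem_erase _ _) h hv ho
  rwa [Finset.insert_erase hq] at this

/-- Sets of fewer than `n` points have open paths starting at any given hull vertex. -/
def VertexPaths (n : ℕ) : Prop :=
  ∀ T : Finset Pt, NoColl T → 2 ≤ T.card → T.card < n → ∀ q ∈ T, OnHull q T →
    ∃ r, OpenPath T q r

/-- Sets of fewer than `n` points have open paths starting with any given hull edge, in one of
its two directions. -/
def EdgePaths (n : ℕ) : Prop :=
  ∀ T : Finset Pt, NoColl T → T.card < n → ∀ p s, HullEdge T p s →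
    OpenPath T p s ∨ OpenPath T s p

lemma openPath_of_ok_all {n : ℕ} (hV : VertexPaths n) {T : Finset Pt} (hT : NoColl T)
    (hn : T.card ≤ n) {x p : Pt} (hx : x ∈ T) (hp : p ∈ T) (hxp : x ≠ p)
    (hvis : Vis x p (T.erase x)) (hok : ∀ t ∈ T, t ≠ x → t ≠ p → Ok x p t) :
    OpenPath T x p := by
  have hc := Finset.card_erase_of_mem hx
  have hsub : {x, p} ⊆ T := by
    intro y hy
    rcases Finset.mem_insert.1 hy with rfl | hy
    · exact hx
    · rw [Finset.mem_singleton.1 hy]; exact hp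
  have hpair : ({x, p} : Finset Pt).card = 2 := Finset.card_pair hxp
  have hle := Finset.card_le_card hsub
  rcases Nat.lt_or_ge 2 T.card with h | h
  · obtain ⟨w, hw⟩ := hV (T.erase x) (hT.mono (Finset.erase_subset _ _)) (by omega) (by omega)
      p (Finset.mem_erase.2 ⟨hxp.symm, hp⟩) hvis.onHull
    obtain ⟨-, hwT, hpw⟩ := hw.mem_ne
    exact hw.cons_erase hx hvis
      (hok w (Finset.mem_of_mem_erase hwT) (Finset.ne_of_mem_erase hwT) hpw.symm)
  · rw [← Finset.eq_of_subset_of_card_le hsub (by omega)]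
    exact OpenPath.two x p hxp

/-- A hull vertex with a narrow hull angle can be the second vertex of an open path starting at
either of its hull neighbours. -/
lemma openPath_of_narrow {n : ℕ} (hV : VertexPaths n) {T : Finset Pt} (hT : NoColl T)
    (hn : T.card ≤ n) {p s l : Pt} (hs : HullEdge T p s) (hl : HullEdge T l p)
    (hok : Ok s p l) : OpenPath T s p ∧ OpenPath T l p := by
  have hsl : ∀ t ∈ T, t ≠ p → (t ≠ s ∨ t ≠ l) → 0 < cr p s l := by
    intro t ht htp hne
    have hsl : s ≠ l := by
      rintro rfl
      have hne : t ≠ s := by tauto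
      have h1 := hs.2.2.2 t ht htp hne
      have h2 := hl.2.2.2 t ht hne htp
      rw [cr_cyc, cr_swap] at h2
      linarith
    exact hs.2.2.2 l hl.1 hl.2.2.1 hsl.symm
  have h1 : ∀ t ∈ T, 0 ≤ cr p s t := fun t ht => hs.nonneg ht
  have h2 : ∀ t ∈ T, 0 ≤ cr p t l := fun t ht => by
    rw [← cr_cyc]; exact hl.nonneg ht
  exact ⟨openPath_of_ok_all hV hT hn hs.2.1 hs.1 hs.2.2.1.symm hs.vis_erase_right
      fun t ht hts htp => (ok_cone (hsl t ht htp (Or.inl hts)) hok (h1 t ht) (h2 t ht)).1,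
    openPath_of_ok_all hV hT hn hl.1 hl.2.1 hl.2.2.1 hl.vis_erase_left
      fun t ht htl htp => (ok_cone (hsl t ht htp (Or.inr htl)) hok (h1 t ht) (h2 t ht)).2⟩

lemma ok_of_dist_le {q s p : Pt} (h : dt q p p ≤ dt q s s) : Ok q s p := by
  apply ok_of_dt
  have e : 2 * dt s q p = dt q s s + dt s p p - dt q p p := by unfold dt; ring
  linarith [dt_self_nonneg s p]

/-- `q` can be put in front of an open path on `T` whose first vertex is `v`. -/
def Extends (q v : Pt) (T : Finset Pt) : Prop := ∃ w, OpenPath T v w ∧ Vis q v T ∧ Ok q v w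

lemma extends_of_edge {n : ℕ} (hE : EdgePaths n) {T : Finset Pt} (hT : NoColl T)
    (hn : T.card < n) {a b q : Pt} (h : HullEdge T a b) (hq : cr a b q < 0) (ha : Ok q a b)
    (hb : Ok q b a) : Extends q a T ∨ Extends q b T := by
  rcases hE T hT hn a b h with hp | hp
  · exact Or.inl ⟨b, hp, h.vis_left hq, ha⟩
  · exact Or.inr ⟨a, hp, h.vis_right hq, hb⟩

lemma extends_of_nearest {n : ℕ} (hV : VertexPaths n) (hE : EdgePaths n) {T : Finset Pt}
    {q p s l : Pt} (hT : NoColl (insert q T)) (hq : q ∉ T) (hn : T.card < n)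
    (hs : HullEdge T p s) (hl : HullEdge T l p) (hvis : cr p s q < 0 ∨ cr l p q < 0)
    (hds : cr p s q < 0 → dt q p p ≤ dt q s s) (hdl : cr l p q < 0 → dt q p p ≤ dt q l l) :
    Extends q p T ∨ (cr p s q < 0 ∧ Extends q s T) ∨ (cr l p q < 0 ∧ Extends q l T) := by
  have hT' : NoColl T := hT.mono (Finset.subset_insert _ _)
  have rl := cr_cyc l p q
  have hnz : ∀ x ∈ T, x ≠ p → cr p q x ≠ 0 := fun x hx hxp =>
    hT p (Finset.mem_insert_of_mem hs.1) q (Finset.mem_insert_self _ _) x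
      (Finset.mem_insert_of_mem hx) (fun h => hq (h ▸ hs.1)) hxp.symm (fun h => hq (h ▸ hx))
  have hsn := hnz s hs.2.1 hs.2.2.1.symm
  have hln := hnz l hl.1 hl.2.2.1
  have hsw := cr_swap p q s
  have hlw := cr_swap p q l
  have hsl : 0 ≤ cr p s l := hs.nonneg hl.1
  rw [rl] at hvis hdl ⊢
  by_cases h1 : cr p s q < 0
  · by_cases hok : Ok q p s
    · rcases extends_of_edge hE hT' hn hs h1 hok (ok_of_dist_le (hds h1)) with h | h
      · exact Or.inl h
      · exact Or.inr (Or.inl ⟨h1, h⟩)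
    · have hb := not_ok_of_pos hok (by linarith)
      have hsl' : Ok s p l ∨ Extends q p T ∨ Extends q l T ∧ cr p q l < 0 := by
        by_cases h2 : cr p q l < 0
        · by_cases hok' : Ok q p l
          · rcases extends_of_edge hE hT' hn hl (by rwa [rl]) (ok_of_dist_le (hdl h2)) hok'
              with h | h
            · exact Or.inr (Or.inr ⟨h, h2⟩)
            · exact Or.inr (Or.inl h)
          · have hb' := not_ok_of_pos (fun h => hok' h.symm) (by linarith)
            rw [dt_comm] at hb'
            exact Or.inl (ok_of_dt
              (dt_pos_of_wide_wide (by linarith) (by linarith) hb hb').le)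
        · have h2 : 0 < cr p q l := lt_of_le_of_ne (not_lt.1 h2) hln.symm
          exact Or.inl (ok_of_dt (dt_nonneg_of_wide (by linarith) h2 hsl hb))
      rcases hsl' with h | h | h
      · exact Or.inr (Or.inl ⟨h1, p, (openPath_of_narrow hV hT' hn.le hs hl h).1,
          hs.vis_right h1, ok_of_dist_le (hds h1)⟩)
      · exact Or.inl h
      · exact Or.inr (Or.inr h.symm)
  · have h2 := hvis.resolve_left h1
    have h1 : 0 < cr p s q := lt_of_le_of_ne (not_lt.1 h1) (by
      intro h; apply hsn; linarith)
    by_cases hok : Ok q p l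
    · rcases extends_of_edge hE hT' hn hl (by rwa [rl]) (ok_of_dist_le (hdl h2)) hok with h | h
      · exact Or.inr (Or.inr ⟨h2, h⟩)
      · exact Or.inl h
    · have hb := not_ok_of_pos (fun h => hok h.symm) (by linarith)
      rw [dt_comm] at hb
      have h := dt_nonneg_of_wide' (by linarith) h1 hsl hb
      exact Or.inr (Or.inr ⟨h2, p, (openPath_of_narrow hV hT' hn.le hs hl (ok_of_dt h)).2,
        hl.vis_left (by rwa [rl]), ok_of_dist_le (hdl h2)⟩)

/-- A vertex visible from `q` is incident to a hull edge whose line separates it from `q`. -/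
lemma Vis.edge_visible {T : Finset Pt} {q p s l : Pt} (hT : NoColl (insert q T)) (hq : q ∉ T)
    (hv : Vis q p T) (hs : HullEdge T p s) (hl : HullEdge T l p) :
    cr p s q < 0 ∨ cr l p q < 0 := by
  have rl := cr_cyc l p q
  have hsn : cr p s q ≠ 0 :=
    hT p (Finset.mem_insert_of_mem hs.1) s (Finset.mem_insert_of_mem hs.2.1)
      q (Finset.mem_insert_self _ _) hs.2.2.1 (fun h => hq (h ▸ hs.1)) (fun h => hq (h ▸ hs.2.1))
  rw [rl]
  by_contra hc
  push Not at hc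
  obtain ⟨h1, h2⟩ := hc
  have h1 : 0 < cr p s q := lt_of_le_of_ne h1 hsn.symm
  obtain ⟨a, b, -, hfq, hf⟩ := hv
  have hsl : s ≠ l := by
    rintro rfl
    rw [cr_swap] at h2
    linarith
  have h3 : 0 < cr p s l := hs.2.2.2 l hl.1 hl.2.2.1 hsl.symm
  have e := lf_plucker a b p s l q
  have hfs := hf s hs.2.1
  have hfl := hf l hl.1
  have i1 := mul_nonneg h2 hfs.1
  have i2 := mul_nonneg h1.le hfl.1
  have i3 := mul_nonneg h3.le (neg_nonneg.2 hfq)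
  have hq0 : lf a b p q = 0 := by
    have : cr p s l * lf a b p q = 0 := by linarith
    exact (mul_eq_zero.1 this).resolve_left h3.ne'
  have hl0 := hfl.2.resolve_left hl.2.2.1
  rw [hq0] at hl0
  have := mul_pos h1 hl0
  linarith

lemma vertex_step {S : Finset Pt} (hS : NoColl S) (hV : VertexPaths S.card)
    (hE : EdgePaths S.card) (h2 : 2 ≤ S.card) {q : Pt} (hq : q ∈ S) (ho : OnHull q S) :
    ∃ r, OpenPath S q r := by
  obtain ⟨u, hu⟩ := exists_hullEdge_from hS hq ho h2
  have hc := Finset.card_erase_of_mem hq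
  have hqT := Finset.notMem_erase q S
  have hins : insert q (S.erase q) = S := Finset.insert_erase hq
  set T := S.erase q with hTdef
  have hT : NoColl (insert q T) := by rwa [hins]
  have huT : u ∈ T := Finset.mem_erase.2 ⟨hu.2.2.1.symm, hu.2.1⟩
  rcases Nat.lt_or_ge S.card 3 with h3 | h3
  · have hS2 : {q, u} = S := by
      apply Finset.eq_of_subset_of_card_le
      · exact Finset.insert_subset hq (Finset.singleton_subset_iff.2 hu.2.1)
      · rw [Finset.card_pair hu.2.2.1]; omega
    exact ⟨u, hS2 ▸ OpenPath.two _ _ hu.2.2.1⟩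
  suffices h : ∃ v, Extends q v T by
    obtain ⟨v, w, h1, h3, h4⟩ := h
    exact ⟨v, h1.cons_erase hq h3 h4⟩
  have hT' : NoColl T := hT.mono (Finset.subset_insert _ _)
  obtain ⟨p, hp, hmin⟩ := (T.filter fun t => Vis q t T).exists_min_image (fun t => dt q t t)
    ⟨u, Finset.mem_filter.2 ⟨huT, hu.vis_erase_left⟩⟩
  obtain ⟨hpT, hpv⟩ := Finset.mem_filter.1 hp
  obtain ⟨s, hs⟩ := exists_hullEdge_from hT' hpT hpv.onHull (by omega)
  obtain ⟨l, hl⟩ := exists_hullEdge_to hT' hpT hpv.onHull (by omega)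
  rcases extends_of_nearest hV hE hT hqT (by omega) hs hl (hpv.edge_visible hT hqT hs hl)
    (fun h => hmin s (Finset.mem_filter.2 ⟨hs.2.1, hs.vis_right h⟩))
    (fun h => hmin l (Finset.mem_filter.2 ⟨hl.1, hl.vis_left h⟩)) with h | h | h
  exacts [⟨p, h⟩, ⟨s, h.2⟩, ⟨l, h.2⟩]

lemma dt_base_swap (a b t : Pt) : dt b a t = dt a b b - dt a b t := by unfold dt; ring

lemma cr_base_swap (a b t : Pt) : cr b a t = -cr a b t := by unfold cr; ring

lemma cr_mul_base (a b p s t : Pt) :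
    dt a b b * cr p s t = (dt a b s - dt a b p) * (cr a b t - cr a b p)
      - (cr a b s - cr a b p) * (dt a b t - dt a b p) := by
  unfold cr dt; ring

lemma dt_mul_base (a b p s t : Pt) :
    dt a b b * dt p s t = (dt a b s - dt a b p) * (dt a b t - dt a b p)
      + (cr a b s - cr a b p) * (cr a b t - cr a b p) := by
  unfold cr dt; ring

lemma dt_outer_eq (a b : Pt) : dt a b a = 0 := by unfold dt; ring

lemma ok_of_dt_nonpos {u a b : Pt} (h : dt u a b ≤ 0) : Ok a b u := by
  apply ok_of_dt
  have e : dt b a u = dt b u u - dt u a b := by unfold dt; ring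
  linarith [dt_self_nonneg b u]

lemma not_ok_left {a b t : Pt} (ht : 0 < cr a b t) (h : ¬ Ok b a t) :
    dt a b t + cr a b t < 0 := not_ok_of_pos h ht.le

lemma not_ok_right {a b t : Pt} (ht : 0 < cr a b t) (h : ¬ Ok a b t) :
    cr a b t < dt a b t - dt a b b := by
  unfold Ok at h
  rw [dt_base_swap, cr_base_swap, abs_neg, abs_of_pos ht] at h
  linarith

lemma ok_right {a b t : Pt} (ht : 0 < cr a b t) (h : Ok a b t) :
    dt a b t - dt a b b ≤ cr a b t := by
  unfold Ok at h
  rw [dt_base_swap, cr_base_swap, abs_neg, abs_of_pos ht] at h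
  linarith

lemma ok_of_cr_nonneg_of_not_ok {a b u z : Pt} (hu : 0 < cr a b u) (hz : 0 < cr a b z)
    (hbad : ¬ Ok b a z) (h : 0 ≤ cr b z u) : Ok a b u := by
  apply ok_of_dt
  have hb := not_ok_left hz hbad
  have e := cr_mul_base a b b z u
  rw [cr_right_eq] at e
  have hE := dt_self_pos hu.ne'
  rw [dt_base_swap]
  by_contra hc
  nlinarith [mul_nonneg hE.le h, mul_pos hz (neg_pos.2 (not_le.1 hc)),
    mul_pos hu (show 0 < dt a b b - dt a b z by linarith)]

lemma cr_neg_of_ok_of_not_ok {a b p y : Pt} (hp : 0 < cr a b p) (hy : 0 < cr a b y)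
    (hok : Ok a b p) (hbad : ¬ Ok a b y) : cr b p y < 0 := by
  have hb := not_ok_right hy hbad
  have ho := ok_right hp hok
  have e := cr_mul_base a b b p y
  rw [cr_right_eq] at e
  have hE := dt_self_pos hp.ne'
  by_contra hc
  nlinarith [mul_nonneg hE.le (not_lt.1 hc), mul_pos hp (sub_pos.2 hb),
    mul_nonneg hy.le (sub_nonneg.2 ho)]

lemma ok_of_not_ok_not_ok {a b s p z : Pt} (hs : 0 < cr a b s) (hz : 0 < cr a b z)
    (hsb : ¬ Ok a b s) (hzb : ¬ Ok b a z) (hpsz : 0 ≤ cr p s z) (hpsa : cr p s a < 0) :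
    Ok a s p := by
  by_contra hc
  have hE := dt_self_pos hs.ne'
  have h1 := not_ok_right hs hsb
  have h2 := not_ok_left hz hzb
  unfold Ok at hc
  have e0 : cr s a p = cr p s a := (cr_cyc p s a).symm
  rw [e0, abs_of_neg hpsa] at hc
  have e1 := cr_mul_base a b p s z
  have e2 := cr_mul_base a b p s a
  have e3 := dt_mul_base a b s a p
  rw [cr_outer_eq, dt_outer_eq] at e2 e3
  have i1 := mul_nonneg hE.le hpsz
  have i2 := mul_pos hE (neg_pos.2 hpsa)
  have i3 := mul_pos hE (neg_pos.2 (not_le.1 hc))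
  rw [e1] at i1
  have i2' : 0 < -(dt a b b * cr p s a) := by linarith
  have i3' : 0 < -(dt a b b * dt s a p) + dt a b b * cr p s a := by linarith
  rw [e2] at i2'
  rw [e2, e3] at i3'
  generalize dt a b b = E at *
  generalize dt a b s = s0 at *
  generalize cr a b s = s1 at *
  generalize dt a b z = z0 at *
  generalize cr a b z = z1 at *
  generalize dt a b p = p0 at *
  generalize cr a b p = p1 at *
  obtain ⟨d0, rfl⟩ : ∃ d0, p0 = d0 + s0 := ⟨p0 - s0, by ring⟩
  obtain ⟨d1, rfl⟩ : ∃ d1, p1 = d1 + s1 := ⟨p1 - s1, by ring⟩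
  have j1 : s1 * d0 < s0 * d1 := by nlinarith
  have j2 : d1 * (s0 - s1) < d0 * (s0 + s1) := by nlinarith
  have hs0 : 0 < s0 - s1 := by linarith
  have hd0 : 0 < d0 := by
    by_contra h
    push Not at h
    nlinarith [mul_lt_mul_of_pos_left j2 (show 0 < s0 by linarith),
      mul_lt_mul_of_pos_right j1 hs0,
      mul_nonneg (neg_nonneg.2 h) (add_nonneg (mul_self_nonneg s0) (mul_self_nonneg s1))]
  have hd1 : 0 < d1 := by
    have : 0 < s0 * d1 := lt_trans (mul_pos hs hd0) j1
    exact pos_of_mul_pos_right this (by linarith)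
  nlinarith [mul_pos hd0 hz, mul_pos hd1 (show 0 < -z0 by linarith)]

lemma dt_pos_of_not_ok_not_ok {a b s p z : Pt} (hs : 0 < cr a b s) (hz : 0 < cr a b z)
    (hp : 0 < cr a b p) (hsb : ¬ Ok a b s) (hzb : ¬ Ok b a z) (h : 0 ≤ cr p b z) :
    0 < dt p b s := by
  have hE := dt_self_pos hs.ne'
  have h1 := not_ok_right hs hsb
  have h2 := not_ok_left hz hzb
  have e1 := cr_mul_base a b p b z
  have e2 := dt_mul_base a b p b s
  rw [cr_right_eq] at e1 e2
  have i1 := mul_nonneg hE.le h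
  rw [e1] at i1
  apply pos_of_mul_pos_right _ hE.le
  rw [e2]
  generalize dt a b b = E at *
  generalize dt a b s = s0 at *
  generalize cr a b s = s1 at *
  generalize dt a b z = z0 at *
  generalize cr a b z = z1 at *
  generalize dt a b p = p0 at *
  generalize cr a b p = p1 at *
  have j : p1 < E - p0 := by
    have : p1 * z1 < (E - p0) * z1 := by
      nlinarith [mul_pos hp hE, mul_pos hp (show 0 < -z0 - z1 by linarith)]
    exact lt_of_mul_lt_mul_right this hz.le
  nlinarith [mul_pos hs (sub_pos.2 j), mul_pos (sub_pos.2 h1) (hp.trans j), sq_nonneg (E - p0),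
    sq_nonneg p1]

/-- The disk with diameter `a b` contains the triangle `a b p` as soon as it contains `p`. -/
lemma dt_nonpos_of_mem_triangle {a b p u : Pt} (hp : 0 < cr a b p) (hu : 0 < cr a b u)
    (h : dt p a b ≤ 0) (h1 : 0 ≤ cr a u p) (h2 : cr b u p ≤ 0) : dt u a b ≤ 0 := by
  have hE := dt_self_pos hp.ne'
  have e1 := cr_mul_base a b a u p
  have e2 := cr_mul_base a b b u p
  have e3 := dt_mul_base a b p a b
  have e4 := dt_mul_base a b u a b
  rw [cr_right_eq] at e2
  rw [cr_right_eq, cr_outer_eq, dt_outer_eq] at e3 e4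
  rw [cr_outer_eq, dt_outer_eq] at e1
  have i1 := mul_nonneg hE.le h1
  have i2 := mul_nonneg hE.le (neg_nonneg.2 h2)
  have i3 := mul_nonneg hE.le (neg_nonneg.2 h)
  rw [e1] at i1
  rw [mul_neg, e2] at i2
  rw [mul_neg, e3] at i3
  by_contra hc
  have i4 := mul_pos hE (not_le.1 hc)
  rw [e4] at i4
  generalize dt a b b = E at *
  generalize dt a b u = u0 at *
  generalize cr a b u = u1 at *
  generalize dt a b p = p0 at *
  generalize cr a b p = p1 at *
  have k3 : p1 * p1 ≤ p0 * (E - p0) := by linarith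
  have k4 : u0 * (E - u0) < u1 * u1 := by linarith
  have hp0 : 0 < p0 := by
    by_contra hn
    nlinarith [mul_pos hp hp, mul_nonneg (neg_nonneg.2 (not_lt.1 hn)) hE.le, sq_nonneg p0]
  have hp0' : 0 < E - p0 := by
    have := (mul_pos hp hp).trans_le k3
    exact pos_of_mul_pos_right this hp0.le
  have k1 : u1 * p0 ≤ u0 * p1 := by linarith
  have k2 : u1 * (E - p0) ≤ (E - u0) * p1 := by linarith
  have k5 := mul_le_mul k1 k2 (mul_pos hu hp0').le ((mul_pos hu hp0).le.trans k1)
  nlinarith [mul_le_mul_of_nonneg_left k3 (mul_pos hu hu).le,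
    mul_lt_mul_of_pos_left k4 (mul_pos hp hp)]

lemma cr_neg_of_vis {T : Finset Pt} {p q s y : Pt} (hv : Vis q p T) (hs : HullEdge T p s)
    (hy : y ∈ T) (hne : cr p s q ≠ 0) (h : cr q p y < 0) : cr p s q < 0 := by
  have e0 : cr p q y = -cr q p y := cr_base_swap q p y
  rcases eq_or_ne y s with rfl | hys
  · rwa [cr_cyc, cr_cyc]
  have hyp : y ≠ p := by
    rintro rfl
    rw [cr_right_eq] at h
    exact lt_irrefl _ h
  have hpy := hs.2.2.2 y hy hyp hys
  by_contra hc
  have hc : 0 < cr p s q := lt_of_le_of_ne (not_lt.1 hc) hne.symm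
  obtain ⟨a, b, -, hfq, hf⟩ := hv
  have e := lf_plucker a b p s y q
  have hfs := hf s hs.2.1
  have hfs' := hfs.2.resolve_left hs.2.2.1.symm
  have hqy : 0 < cr p q y := by linarith
  have i1 := mul_nonneg hqy.le hfs.1
  have i2 := mul_nonneg hc.le (hf y hy).1
  have i3 := mul_nonneg hpy.le (neg_nonneg.2 hfq)
  have hq0 : lf a b p q = 0 := by
    have : cr p s y * lf a b p q = 0 := by linarith
    exact (mul_eq_zero.1 this).resolve_left hpy.ne'
  rw [hq0] at hfs'
  have := mul_pos hqy hfs'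
  linarith

/-- When the nearest admissible vertex `p` is not on the side of `a` of the edge `p s`, a path
may start along `a b` and continue at the other neighbour `u` of `a` on the hull. -/
lemma extends_of_thales {n : ℕ} (hV : VertexPaths n) {T : Finset Pt} (hT : NoColl T)
    (h2 : 2 ≤ T.card) (hn : T.card < n) {a b p s u : Pt} (hpos : ∀ t ∈ T, 0 < cr a b t)
    (hs : HullEdge T p s) (hu : u ∈ T) (hau : ∀ t ∈ T, t ≠ u → 0 < cr a u t)
    (hb : cr p s b < 0) (ha : 0 < cr p s a) (hd : 0 < dt p b s) :
    (Ok b a u ∧ Extends a u T) ∨ (Ok a b u ∧ Extends b u T) := by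
  have hup := hpos u hu
  have hpp := hpos p hs.1
  have hau_ne : a ≠ u := by
    rintro rfl
    rw [cr_outer_eq] at hup
    exact lt_irrefl _ hup
  have hau' : ∀ t ∈ T, 0 ≤ cr a u t := fun t ht => by
    rcases eq_or_ne t u with rfl | h
    · exact (cr_right_eq _ _).ge
    · exact (hau t ht h).le
  have hsw1 := cr_swap p a s
  have hsw2 := cr_swap p b u
  have hc1 := cr_cyc p a b
  have hc2 := cr_cyc p a u
  have hc3 := cr_cyc p b u
  have hdp : dt p a b ≤ 0 := by
    have e := dt_plucker p a b s b
    rw [dt_comm p a b] at e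
    have i1 := mul_pos (hc1 ▸ hpp) hd
    have i2 := mul_nonneg ha.le (dt_self_nonneg p b)
    by_contra hc
    nlinarith [mul_pos (neg_pos.2 hb) (not_le.1 hc)]
  have hbu : cr b u p ≤ 0 := by
    by_contra hc
    have e : cr p a b * cr p s u = cr p u b * cr p s a + cr p a u * cr p s b := by
      unfold cr; ring
    have i0 := mul_nonneg (hc1 ▸ hpp).le (hs.nonneg hu)
    have i1 := mul_pos (hc3 ▸ not_le.1 hc) ha
    have i2 := mul_nonneg (hc2 ▸ hau' p hs.1) (neg_nonneg.2 hb.le)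
    rw [hsw2] at e
    linarith
  have hdu := dt_nonpos_of_mem_triangle hpp hup hdp (hau' p hs.1) hbu
  have hub : cr a u b < 0 := by rw [cr_swap]; linarith
  have hva : Vis a u T := vis_of_line hau_ne (cr_right_eq _ _) (cr_outer_eq _ _).le
    fun t ht => ⟨hau' t ht, or_iff_not_imp_left.2 fun h => by
      rw [cr_outer_eq]; exact hau t ht h⟩
  have hvb : Vis b u T := vis_of_line hau_ne (cr_right_eq _ _) hub.le
    fun t ht => ⟨hau' t ht, Or.inr (hub.trans_le (hau' t ht))⟩
  obtain ⟨w, hw⟩ := hV T hT h2 hn u hu hva.onHull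
  rcases ok_or_ok (w := w) hdu with h | h
  · exact Or.inl ⟨ok_of_dt_nonpos (by rwa [dt_comm]), w, hw, hva, h⟩
  · exact Or.inr ⟨ok_of_dt_nonpos hdu, w, hw, hvb, h⟩

/-- If both ends of the hull edge `a b` see a point at a wide angle, a path on the remaining
points can be extended by one of them and then by the other. -/
lemma extends_edge {n : ℕ} (hV : VertexPaths n) (hE : EdgePaths n) {T : Finset Pt} {a b u v : Pt}
    (hT : NoColl (insert a (insert b T))) (haT : a ∉ T) (hbT : b ∉ T) (hn : T.card < n)
    (hpos : ∀ t ∈ T, 0 < cr a b t) (hu : HullEdge (insert a T) a u)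
    (hv : HullEdge (insert b T) v b) {y z : Pt} (hy : y ∈ T) (hz : z ∈ T)
    (hyb : ¬ Ok a b y) (hzb : ¬ Ok b a z) :
    ∃ x, (Ok a b x ∧ Extends b x T) ∨ (Ok b a x ∧ Extends a x T) := by
  have hTb : NoColl (insert b T) := hT.mono (Finset.subset_insert _ _)
  have hT' : NoColl T := hTb.mono (Finset.subset_insert _ _)
  have hcard : 2 ≤ T.card := by
    have hyz : y ≠ z := by
      rintro rfl
      have := not_ok_right (hpos y hy) hyb
      have := not_ok_left (hpos y hy) hzb
      linarith [dt_self_nonneg a b, hpos y hy]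
    rw [← Finset.card_pair hyz]
    exact Finset.card_le_card (Finset.insert_subset hy (Finset.singleton_subset_iff.2 hz))
  have huT : u ∈ T := Finset.mem_of_mem_insert_of_ne hu.2.1 hu.2.2.1.symm
  have hvT : v ∈ T := Finset.mem_of_mem_insert_of_ne hv.1 hv.2.2.1
  have hvis : Vis b v T := by
    have := hv.vis_erase_right
    rwa [Finset.erase_insert hbT] at this
  have hokv : Ok a b v := by
    refine ok_of_cr_nonneg_of_not_ok (hpos v hvT) (hpos z hz) hzb ?_
    rw [← cr_cyc]
    exact hv.nonneg (Finset.mem_insert_of_mem hz)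
  obtain ⟨p, hp, hmin⟩ := (T.filter fun t => Vis b t T ∧ Ok a b t).exists_min_image
    (fun t => dt b t t) ⟨v, Finset.mem_filter.2 ⟨hvT, hvis, hokv⟩⟩
  obtain ⟨hpT, hpv, hpo⟩ := Finset.mem_filter.1 hp
  obtain ⟨s, hs⟩ := exists_hullEdge_from hT' hpT hpv.onHull hcard
  obtain ⟨l, hl⟩ := exists_hullEdge_to hT' hpT hpv.onHull hcard
  have hps := hpos s hs.2.1
  have hnz : ∀ x ∈ insert a (insert b T), x ∉ T → cr p s x ≠ 0 := fun x hx hxT =>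
    hT p (by simp [hpT]) s (by simp [hs.2.1]) x hx hs.2.2.1 (fun h => hxT (h ▸ hpT))
      (fun h => hxT (h ▸ hs.2.1))
  have hsb : cr p s b < 0 := cr_neg_of_vis hpv hs hy (hnz b (by simp) hbT)
    (cr_neg_of_ok_of_not_ok (hpos p hpT) (hpos y hy) hpo hyb)
  have rl := cr_cyc l p b
  have hlo : cr l p b < 0 → Ok a b l := fun h => by
    by_contra hlb
    have h1 := cr_neg_of_ok_of_not_ok (hpos p hpT) (hpos l hl.1) hpo hlb
    have h2 := cr_cyc b l p
    have h3 := cr_swap b p l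
    linarith
  have hlm : cr l p b < 0 → dt b p p ≤ dt b l l := fun h =>
    hmin l (Finset.mem_filter.2 ⟨hl.1, hl.vis_left h, hlo h⟩)
  by_cases hso : Ok a b s
  · rcases extends_of_nearest hV hE hTb hbT hn hs hl (Or.inl hsb)
      (fun h => hmin s (Finset.mem_filter.2 ⟨hs.2.1, hs.vis_right h, hso⟩)) hlm with h | h | h
    exacts [⟨p, Or.inl ⟨hpo, h⟩⟩, ⟨s, Or.inl ⟨hso, h.2⟩⟩, ⟨l, Or.inl ⟨hlo h.1, h.2⟩⟩]
  have hswb := cr_swap p s b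
  have hsl : cr p l b ≠ 0 := hTb p (by simp [hpT]) l (by simp [hl.1]) b (by simp)
    hl.2.2.1.symm (fun h => hbT (h ▸ hpT)) (fun h => hbT (h ▸ hl.1))
  have hswl := cr_swap p l b
  suffices h : (∃ x, (Ok a b x ∧ Extends b x T)) ∨ 0 < dt p b s by
    rcases h with ⟨x, hx⟩ | hd
    · exact ⟨x, Or.inl hx⟩
    by_cases ha : cr p s a < 0
    · rcases hE T hT' hn p s hs with h | h
      · exact ⟨p, Or.inl ⟨hpo, s, h, hpv, ok_of_dt hd.le⟩⟩
      · have h1 := not_ok_right hps hso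
        exact ⟨s, Or.inr ⟨ok_of_dt (by linarith [dt_self_nonneg a b]), p, h, hs.vis_right ha,
          ok_of_not_ok_not_ok hps (hpos z hz) hso hzb (hs.nonneg hz) ha⟩⟩
    · have ha : 0 < cr p s a := lt_of_le_of_ne (not_lt.1 ha) (hnz a (by simp) haT).symm
      rcases extends_of_thales hV hT' hcard hn hpos hs huT (fun t ht htu => hu.2.2.2 t
        (Finset.mem_insert_of_mem ht) (fun h => haT (h ▸ ht)) htu) hsb ha hd with h | h
      exacts [⟨u, Or.inr h⟩, ⟨u, Or.inl h⟩]
  by_cases h1 : cr l p b < 0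
  · by_cases hpl : Ok b p l
    · rcases extends_of_edge hE hT' hn hl h1 (ok_of_dist_le (hlm h1)) hpl with h | h
      exacts [Or.inl ⟨l, hlo h1, h⟩, Or.inl ⟨p, hpo, h⟩]
    by_cases hspl : Ok s p l
    · exact Or.inl ⟨l, hlo h1, p, (openPath_of_narrow hV hT' hn.le hs hl hspl).2,
        hl.vis_left h1, ok_of_dist_le (hlm h1)⟩
    have hne : l ≠ s := by
      rintro rfl
      linarith
    have h2 := hs.2.2.2 l hl.1 hl.2.2.1 hne
    have b1 := not_ok_of_pos (fun h => hpl h.symm) (show 0 ≤ cr p l b by linarith)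
    have b2 := not_ok_of_pos hspl h2.le
    rw [dt_comm] at b2
    exact Or.inr (dt_pos_of_wide_wide (by linarith) h2 b1 b2)
  · have h1 : 0 < cr p b l := lt_of_le_of_ne (by linarith) (by
      intro h; apply hsl; linarith)
    refine Or.inr (dt_pos_of_not_ok_not_ok hps (hpos z hz) (hpos p hpT) hso hzb ?_)
    rcases eq_or_ne z p with rfl | hzp
    · exact (cr_outer_eq _ _).ge
    rcases eq_or_ne z s with rfl | hzs
    · linarith
    rcases eq_or_ne l s with rfl | hls
    · have h2 := hs.2.2.2 z hz hzp hzs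
      have h3 := hl.2.2.2 z hz hzs hzp
      rw [cr_base_swap] at h3
      linarith
    have h2 := hs.2.2.2 l hl.1 hl.2.2.1 hls
    have h3 := hl.nonneg hz
    rw [cr_cyc] at h3
    have e := cr_plucker p s l z b
    refine nonneg_of_mul_nonneg_right (?_ : 0 ≤ cr p s l * cr p b z) h2
    rw [e]
    exact add_nonneg (mul_nonneg h3 (by linarith)) (mul_nonneg (hs.nonneg hz) h1.le)

lemma edge_step {S : Finset Pt} (hS : NoColl S) (hV : VertexPaths S.card)
    (hE : EdgePaths S.card) {a b : Pt} (hab : HullEdge S a b) :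
    OpenPath S a b ∨ OpenPath S b a := by
  by_cases h1 : ∀ t ∈ S, t ≠ a → t ≠ b → Ok a b t
  · exact Or.inl (openPath_of_ok_all hV hS le_rfl hab.1 hab.2.1 hab.2.2.1 hab.vis_erase_left h1)
  by_cases h2 : ∀ t ∈ S, t ≠ a → t ≠ b → Ok b a t
  · exact Or.inr (openPath_of_ok_all hV hS le_rfl hab.2.1 hab.1 hab.2.2.1.symm
      hab.vis_erase_right fun t ht hb ha => h2 t ht ha hb)
  push Not at h1 h2
  obtain ⟨y, hyS, hya, hyb, hy⟩ := h1
  obtain ⟨z, hzS, hza, hzb, hz⟩ := h2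
  have hne := hab.2.2.1
  obtain ⟨T, haT, hbT, rfl⟩ : ∃ T, a ∉ T ∧ b ∉ T ∧ S = insert a (insert b T) := by
    refine ⟨(S.erase a).erase b, by simp, by simp, ?_⟩
    rw [Finset.insert_erase (Finset.mem_erase.2 ⟨hne.symm, hab.2.1⟩),
      Finset.insert_erase hab.1]
  have ha : a ∉ insert b T := by simp [hne, haT]
  have hb : b ∉ insert a T := by simp [hne.symm, hbT]
  have ea : (insert a (insert b T)).erase a = insert b T := Finset.erase_insert ha
  have eb : (insert a (insert b T)).erase b = insert a T := by
    rw [Finset.insert_comm, Finset.erase_insert hb]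
  have va : Vis a b (insert b T) := ea ▸ hab.vis_erase_left
  have vb : Vis b a (insert a T) := eb ▸ hab.vis_erase_right
  have hyT : y ∈ T := by simpa [hya, hyb] using hyS
  have hzT : z ∈ T := by simpa [hza, hzb] using hzS
  have hTpos : 0 < T.card := Finset.card_pos.2 ⟨y, hyT⟩
  have ca := Finset.card_insert_of_notMem haT
  have cb := Finset.card_insert_of_notMem hbT
  have cS := Finset.card_insert_of_notMem ha
  obtain ⟨u, hu⟩ := exists_hullEdge_from (hS.mono (by rw [← eb]; exact Finset.erase_subset _ _))
    (Finset.mem_insert_self a T) vb.onHull (by omega)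
  obtain ⟨v, hv⟩ := exists_hullEdge_to (hS.mono (Finset.subset_insert _ _))
    (Finset.mem_insert_self b T) va.onHull (by omega)
  obtain ⟨x, ⟨ho, w, hw, hvis, hok⟩ | ⟨ho, w, hw, hvis, hok⟩⟩ :=
    extends_edge hV hE hS haT hbT (by omega) (fun t ht => hab.2.2.2 t (by simp [ht])
      (fun h => haT (h ▸ ht)) (fun h => hbT (h ▸ ht))) hu hv hyT hzT hy hz
  · exact Or.inl (.cons _ a b x ha (.cons _ b x w hbT hw hvis hok) va ho)
  · rw [Finset.insert_comm]
    exact Or.inr (.cons _ b a x hb (.cons _ a x w haT hw hvis hok) vb ho)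

lemma vertexPaths_and_edgePaths (n : ℕ) : VertexPaths n ∧ EdgePaths n := by
  induction n with
  | zero => exact ⟨fun T _ _ h => absurd h (Nat.not_lt_zero _),
      fun T _ h => absurd h (Nat.not_lt_zero _)⟩
  | succ n ih =>
    refine ⟨fun T hT h2 hn q hq ho => ?_, fun T hT hn p s h => ?_⟩
    · rcases (Nat.lt_succ_iff.1 hn).lt_or_eq with h | rfl
      · exact ih.1 T hT h2 h q hq ho
      · exact vertex_step hT ih.1 ih.2 h2 hq ho
    · rcases (Nat.lt_succ_iff.1 hn).lt_or_eq with h' | rfl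
      · exact ih.2 T hT h' p s h
      · exact edge_step hT ih.1 ih.2 h

lemma exists_openPath {S : Finset Pt} (hS : NoColl S) (h2 : 2 ≤ S.card) :
    ∃ q r, OpenPath S q r := by
  obtain ⟨q, hq, hmin⟩ := S.exists_min_image (fun t => t 0) (Finset.card_pos.1 (by omega))
  obtain ⟨r, hr⟩ := (vertexPaths_and_edgePaths (S.card + 1)).1 S hS h2 (Nat.lt_succ_self _) q hq
    ⟨1, 0, Or.inl one_ne_zero, fun t ht => by unfold lf; linarith [hmin t ht]⟩
  exact ⟨q, r, hr⟩

lemma inner_sub_sub (p a b : Pt) : inner ℝ (a - p) (b - p) = dt p a b := by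
  simp only [PiLp.inner_apply, Fin.sum_univ_two, PiLp.sub_apply, RCLike.inner_apply,
    conj_trivial, dt]
  ring

lemma cos_le_inner_unit {p a b : Pt} (ha : a ≠ p) (hb : b ≠ p) (h : Ok a p b) :
    -(√2 / 2) ≤ inner ℝ ((‖a - p‖)⁻¹ • (a - p)) ((‖b - p‖)⁻¹ • (b - p)) := by
  have na : 0 < ‖a - p‖ := norm_pos_iff.2 (sub_ne_zero.2 ha)
  have nb : 0 < ‖b - p‖ := norm_pos_iff.2 (sub_ne_zero.2 hb)
  rw [real_inner_smul_left, real_inner_smul_right, inner_sub_sub, ← mul_assoc, ← mul_inv,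
    inv_mul_eq_div, le_div_iff₀ (mul_pos na nb)]
  have e : (‖a - p‖ * ‖b - p‖) ^ 2 = dt p a b ^ 2 + cr p a b ^ 2 := by
    rw [mul_pow, ← real_inner_self_eq_norm_sq, ← real_inner_self_eq_norm_sq, inner_sub_sub,
      inner_sub_sub]
    unfold dt cr; ring
  have hm := mul_pos na nb
  generalize ‖a - p‖ * ‖b - p‖ = m at *
  unfold Ok at h
  by_contra hc
  have h2 : (√2) ^ 2 = 2 := Real.sq_sqrt (by norm_num)
  have h0 : 0 ≤ √2 := Real.sqrt_nonneg 2
  have h3 : √2 / 2 * m < - dt p a b := by linarith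
  have h4 : (√2 / 2 * m) ^ 2 < (- dt p a b) ^ 2 := pow_lt_pow_left₀ h3 (by positivity) two_ne_zero
  have h5 : (- dt p a b) ^ 2 ≤ |cr p a b| ^ 2 := by
    apply pow_le_pow_left₀ _ (by linarith)
    exact (show 0 ≤ √2 / 2 * m by positivity).trans h3.le
  rw [sq_abs] at h5
  nlinarith

/-- Two unit vectors at angle at most `3π/4` are within `3π/8` of their bisector. -/
lemma angle_add_le {x y : Pt} (hx : ‖x‖ = 1) (hy : ‖y‖ = 1) (h : -(√2 / 2) ≤ inner ℝ x y) :
    x + y ≠ 0 ∧ InnerProductGeometry.angle (x + y) x ≤ 3 * Real.pi / 8 := by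
  have h2 : (√2) ^ 2 = 2 := Real.sq_sqrt (by norm_num)
  have h0 : 0 ≤ √2 := Real.sqrt_nonneg 2
  have h1 : √2 < 2 := by nlinarith
  have e := norm_add_sq_real x y
  rw [hx, hy] at e
  have hpos : 0 < ‖x + y‖ ^ 2 := by linarith
  have hne : x + y ≠ 0 := by
    intro h
    rw [h, norm_zero] at hpos
    norm_num at hpos
  refine ⟨hne, ?_⟩
  have hn : 0 < ‖x + y‖ := norm_pos_iff.2 hne
  have hi : inner ℝ (x + y) x = ‖x + y‖ ^ 2 / 2 := by
    rw [inner_add_left, real_inner_self_eq_norm_sq, hx, real_inner_comm]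
    linarith
  unfold InnerProductGeometry.angle
  rw [hi, hx, mul_one, show ‖x + y‖ ^ 2 / 2 / ‖x + y‖ = ‖x + y‖ / 2 by field_simp]
  have hc : Real.cos (3 * Real.pi / 8) ≤ ‖x + y‖ / 2 := by
    have hs : Real.cos (3 * Real.pi / 8) = √(2 - √2) / 2 := by
      rw [← Real.sin_pi_div_eight, ← Real.cos_pi_div_two_sub]
      congr 1; ring
    rw [hs]
    have : √(2 - √2) ≤ ‖x + y‖ := Real.sqrt_le_iff.2 ⟨hn.le, by linarith⟩
    linarith
  have hpi := Real.pi_pos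
  rw [← Real.arccos_cos (x := 3 * Real.pi / 8) (by positivity) (by linarith)]
  exact Real.arccos_le_arccos hc

lemma vertexOpen_of_ok {S : Finset Pt} {G : PSLG S} {p a b : Pt} (ha : a ≠ p) (hb : b ≠ p)
    (hok : Ok a p b) (h : ∀ x, (p, x) ∈ G.E → x = a ∨ x = b) :
    VertexOpen G p (5 * Real.pi / 4) := by
  have na : 0 < ‖a - p‖ := norm_pos_iff.2 (sub_ne_zero.2 ha)
  have nb : 0 < ‖b - p‖ := norm_pos_iff.2 (sub_ne_zero.2 hb)
  have ua : ‖(‖a - p‖)⁻¹ • (a - p)‖ = 1 := norm_smul_inv_norm (sub_ne_zero.2 ha)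
  have ub : ‖(‖b - p‖)⁻¹ • (b - p)‖ = 1 := norm_smul_inv_norm (sub_ne_zero.2 hb)
  have hi := cos_le_inner_unit ha hb hok
  obtain ⟨hd, h1⟩ := angle_add_le ua ub hi
  obtain ⟨-, h2⟩ := angle_add_le ub ua (by rwa [real_inner_comm])
  rw [InnerProductGeometry.angle_smul_right_of_pos _ _ (inv_pos.2 na)] at h1
  rw [InnerProductGeometry.angle_smul_right_of_pos _ _ (inv_pos.2 nb), add_comm] at h2
  refine ⟨_, hd, fun x hx => ?_⟩
  rw [show Real.pi - 5 * Real.pi / 4 / 2 = 3 * Real.pi / 8 by ring]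
  rcases h x hx with rfl | rfl
  exacts [h1, h2]

lemma vertexOpen_of_forall_eq {S : Finset Pt} {G : PSLG S} {p a : Pt} (ha : a ≠ p)
    (h : ∀ x, (p, x) ∈ G.E → x = a) : VertexOpen G p (5 * Real.pi / 4) :=
  vertexOpen_of_ok ha ha (ok_of_dt (dt_self_nonneg p a)) fun x hx => Or.inl (h x hx)

lemma exists_coord_of_mem_segment {x a b : Pt} (h : x ∈ segment ℝ a b) :
    ∃ s t : ℝ, 0 ≤ s ∧ 0 ≤ t ∧ s + t = 1 ∧ s • a + t • b = x ∧
      ∀ i, x i = s * a i + t * b i := by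
  obtain ⟨s, t, hs, ht, hst, rfl⟩ := h
  exact ⟨s, t, hs, ht, hst, rfl, fun i => by simp⟩

lemma eq_endpoint_of_mem_segment {S : Finset Pt} (hS : NoColl S) {v a b : Pt} (hv : v ∈ S)
    (ha : a ∈ S) (hb : b ∈ S) (hab : a ≠ b) (h : v ∈ segment ℝ a b) : v = a ∨ v = b := by
  by_contra hc
  push Not at hc
  obtain ⟨s, t, -, -, hst, -, hx⟩ := exists_coord_of_mem_segment h
  apply hS a ha b hb v hv hab hc.1.symm hc.2.symm
  obtain rfl : s = 1 - t := by linarith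
  unfold cr
  rw [hx, hx]
  ring

/-- A segment from `q` to a vertex visible from `q` meets an edge on `T` only in a common end. -/
lemma Vis.noncross {T : Finset Pt} (hT : NoColl T) {q v a b x : Pt} (hvT : v ∈ T)
    (hv : Vis q v T) (ha : a ∈ T) (hb : b ∈ T) (hab : a ≠ b) (hx : x ∈ segment ℝ q v)
    (hx' : x ∈ segment ℝ a b) : x = v ∧ (x = a ∨ x = b) := by
  suffices h : x = v from ⟨h, eq_endpoint_of_mem_segment hT (h ▸ hvT) ha hb hab hx'⟩
  obtain ⟨A, B, -, hq, hf⟩ := hv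
  obtain ⟨s, t, hs, ht, hst, hxe, hxi⟩ := exists_coord_of_mem_segment hx
  obtain ⟨s', t', hs', ht', hst', hxe', hxi'⟩ := exists_coord_of_mem_segment hx'
  have e1 : lf A B v x = s * lf A B v q := by
    obtain rfl : t = 1 - s := by linarith
    unfold lf; rw [hxi, hxi]; ring
  have e2 : lf A B v x = s' * lf A B v a + t' * lf A B v b := by
    obtain rfl : t' = 1 - s' := by linarith
    unfold lf; rw [hxi', hxi']; ring
  have i1 := mul_nonneg hs (neg_nonneg.2 hq)
  have i2 := mul_nonneg hs' (hf a ha).1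
  have i3 := mul_nonneg ht' (hf b hb).1
  have z1 : s * lf A B v q = 0 := by linarith
  have z2 : s' * lf A B v a = 0 := by linarith
  have z3 : t' * lf A B v b = 0 := by linarith
  rcases mul_eq_zero.1 z1 with rfl | hq0
  · obtain rfl : t = 1 := by linarith
    rw [← hxe, zero_smul, one_smul, zero_add]
  rw [hq0] at hf
  have key : ∀ c ∈ T, ∀ r : ℝ, r * lf A B v c = 0 → r = 0 ∨ c = v := fun c hc r h =>
    (mul_eq_zero.1 h).imp_right fun h0 => (hf c hc).2.resolve_right h0.not_gt
  rcases key a ha _ z2 with rfl | rfl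
  · obtain rfl : t' = 1 := by linarith
    rcases key b hb _ z3 with h | rfl
    · norm_num at h
    · rw [← hxe', zero_smul, one_smul, zero_add]
  · rcases key b hb _ z3 with rfl | h
    · obtain rfl : s' = 1 := by linarith
      rw [← hxe', zero_smul, one_smul, add_zero]
    · exact absurd h.symm hab

/-- The graph consisting of a single edge. -/
noncomputable def PSLG.single (q v : Pt) (h : q ≠ v) : PSLG {q, v} where
  E := {(q, v), (v, q)}
  symm := by
    intro e he
    simp only [Finset.mem_insert, Finset.mem_singleton] at he ⊢
    rcases he with rfl | rfl <;> simp
  endpts := by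
    intro e he
    simp only [Finset.mem_insert, Finset.mem_singleton] at he ⊢
    rcases he with rfl | rfl <;> simp
  ne := by
    intro e he
    simp only [Finset.mem_insert, Finset.mem_singleton] at he
    rcases he with rfl | rfl
    exacts [h, h.symm]
  noncross := by
    intro e he f hf h1 h2
    simp only [Finset.mem_insert, Finset.mem_singleton] at he hf
    rcases he with rfl | rfl <;> rcases hf with rfl | rfl <;> simp at h1 h2

/-- Adding a pendant edge from a new point `q` to a vertex visible from it. -/
noncomputable def PSLG.extend {T : Finset Pt} (G : PSLG T) (hT : NoColl T) (q v : Pt)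
    (hq : q ∉ T) (hvT : v ∈ T) (hv : Vis q v T) : PSLG (insert q T) where
  E := insert (q, v) (insert (v, q) G.E)
  symm := by
    intro e he
    simp only [Finset.mem_insert] at he ⊢
    rcases he with rfl | rfl | he
    · simp
    · simp
    · exact Or.inr (Or.inr (G.symm e he))
  endpts := by
    intro e he
    simp only [Finset.mem_insert] at he ⊢
    rcases he with rfl | rfl | he
    · simp [hvT]
    · simp [hvT]
    · exact ⟨Or.inr (G.endpts e he).1, Or.inr (G.endpts e he).2⟩
  ne := by
    have hqv : q ≠ v := fun h => hq (h ▸ hvT)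
    intro e he
    simp only [Finset.mem_insert] at he
    rcases he with rfl | rfl | he
    exacts [hqv, hqv.symm, G.ne e he]
  noncross := by
    have key : ∀ f ∈ G.E, ∀ x, x ∈ segment ℝ q v → x ∈ segment ℝ f.1 f.2 →
        x = v ∧ (x = f.1 ∨ x = f.2) := fun f hf x hx hx' =>
      hv.noncross hT hvT (G.endpts f hf).1 (G.endpts f hf).2 (G.ne f hf) hx hx'
    intro e he f hf h1 h2 x hx hx'
    simp only [Finset.mem_insert] at he hf
    rcases he with rfl | rfl | he <;> rcases hf with rfl | rfl | hf
    · exact absurd rfl h1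
    · exact absurd rfl h2
    · exact (key f hf x hx hx').imp_left Or.inr
    · exact absurd rfl h2
    · exact absurd rfl h1
    · rw [segment_symm] at hx
      exact (key f hf x hx hx').imp_left Or.inl
    · exact ((key e he x hx' hx).imp_left Or.inr).symm
    · rw [segment_symm] at hx'
      exact ((key e he x hx' hx).imp_left Or.inl).symm
    · exact G.noncross e he f hf h1 h2 x hx hx'

lemma VertexOpen.congr {S T : Finset Pt} {G : PSLG S} {H : PSLG T} {p : Pt} {φ : ℝ}
    (h : VertexOpen G p φ) (hE : ∀ x, (p, x) ∈ H.E → (p, x) ∈ G.E) : VertexOpen H p φ := by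
  obtain ⟨d, hd, h⟩ := h
  exact ⟨d, hd, fun x hx => h x (hE x hx)⟩

lemma OpenPath.exists_pslg {S : Finset Pt} {q r : Pt} (h : OpenPath S q r) (hS : NoColl S) :
    ∃ G : PSLG S, G.IsSpanningPath ∧ G.IsPhiOpen (5 * Real.pi / 4) ∧
      ∀ x, (q, x) ∈ G.E ↔ x = r := by
  induction h with
  | two q v hqv =>
    have hc : (PSLG.single q v hqv).E.card = 2 := Finset.card_pair (by simp [hqv])
    refine ⟨PSLG.single q v hqv, ⟨⟨?_, ?_⟩, ?_⟩, ?_, ?_⟩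
    · intro a ha b hb
      simp only [Finset.mem_insert, Finset.mem_singleton] at ha hb
      rcases ha with rfl | rfl <;> rcases hb with rfl | rfl
      · exact .refl
      · exact .single (by simp [PSLG.single])
      · exact .single (by simp [PSLG.single])
      · exact .refl
    · rw [hc, Finset.card_pair hqv]
    · exact fun p _ => (Finset.card_filter_le _ _).trans hc.le
    · intro p hp
      simp only [Finset.mem_insert, Finset.mem_singleton] at hp
      rcases hp with rfl | rfl
      · exact vertexOpen_of_forall_eq hqv.symm (by simp [PSLG.single, hqv])
      · exact vertexOpen_of_forall_eq hqv (by simp [PSLG.single, hqv.symm])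
    · simp [PSLG.single, hqv]
  | cons T q v w hq hp hv hok ih =>
    have hT : NoColl T := hS.mono (Finset.subset_insert _ _)
    obtain ⟨G, ⟨⟨hconn, hcard⟩, hdeg⟩, hopen, hG⟩ := ih hT
    obtain ⟨hvT, hwT, hvw⟩ := hp.mem_ne
    have hqv : q ≠ v := fun h => hq (h ▸ hvT)
    have hqw : q ≠ w := fun h => hq (h ▸ hwT)
    have hq1 : ∀ x, (q, x) ∉ G.E := fun x hx => hq (G.endpts _ hx).1
    have hq2 : ∀ x, (x, q) ∉ G.E := fun x hx => hq (G.endpts _ hx).2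
    set H := G.extend hT q v hq hvT hv
    have hHE : H.E = insert (q, v) (insert (v, q) G.E) := rfl
    have hmem : ∀ x y, (x, y) ∈ H.E ↔ (x = q ∧ y = v) ∨ (x = v ∧ y = q) ∨ (x, y) ∈ G.E := by
      intro x y
      rw [hHE]
      simp [Prod.ext_iff]
    have hHq : ∀ x, (q, x) ∈ H.E ↔ x = v := by
      intro x
      rw [hmem]
      simp [hqv, hq1]
    have hHv : ∀ x, (v, x) ∈ H.E → x = q ∨ x = w := by
      intro x
      rw [hmem, hG]
      simp [hqv.symm]
    have hHp : ∀ p, p ≠ q → p ≠ v → ∀ x, (p, x) ∈ H.E ↔ (p, x) ∈ G.E := by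
      intro p h1 h2 x
      rw [hmem]
      simp [h1, h2]
    refine ⟨H, ⟨⟨?_, ?_⟩, ?_⟩, ?_, hHq⟩
    · have hmono : ∀ a ∈ T, ∀ b ∈ T, Relation.ReflTransGen (fun a b => (a, b) ∈ H.E) a b :=
        fun a ha b hb => Relation.ReflTransGen.mono
          (fun x y h => (hmem x y).2 (Or.inr (Or.inr h))) _ _ (hconn a ha b hb)
      have h1 : (q, v) ∈ H.E := by simp [hHE]
      have h2 : (v, q) ∈ H.E := by simp [hHE]
      intro a ha b hb
      rcases Finset.mem_insert.1 ha with rfl | ha'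
      · rcases Finset.mem_insert.1 hb with rfl | hb'
        · exact .refl
        · exact .head h1 (hmono v hvT b hb')
      · rcases Finset.mem_insert.1 hb with rfl | hb'
        · exact .tail (hmono a ha' v hvT) h2
        · exact hmono a ha' b hb'
    · have hpos : 0 < T.card := Finset.card_pos.2 ⟨v, hvT⟩
      rw [hHE, Finset.card_insert_of_notMem (by simp [hqv, hq1]),
        Finset.card_insert_of_notMem (hq2 v), Finset.card_insert_of_notMem hq, hcard]
      omega
    · intro p hp
      unfold PSLG.deg
      by_cases h1 : p = q
      · subst h1
        refine (Finset.card_le_card (t := {(p, v)}) ?_).trans (by simp)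
        rintro ⟨x, y⟩ he
        obtain ⟨he, rfl⟩ := Finset.mem_filter.1 he
        simp [(hHq y).1 he]
      by_cases h2 : p = v
      · subst h2
        refine (Finset.card_le_card (t := {(p, q), (p, w)}) ?_).trans Finset.card_le_two
        rintro ⟨x, y⟩ he
        obtain ⟨he, rfl⟩ := Finset.mem_filter.1 he
        rcases hHv y he with rfl | rfl <;> simp
      · refine (Finset.card_le_card ?_).trans (hdeg p (Finset.mem_of_mem_insert_of_ne hp h1))
        rintro ⟨x, y⟩ he
        obtain ⟨hxy, hx⟩ := Finset.mem_filter.1 he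
        obtain rfl : x = p := hx
        exact Finset.mem_filter.2 ⟨(hHp x h1 h2 y).1 hxy, rfl⟩
    · intro p hp
      by_cases h1 : p = q
      · subst h1
        exact vertexOpen_of_forall_eq hqv.symm fun x hx => (hHq x).1 hx
      by_cases h2 : p = v
      · subst h2
        exact vertexOpen_of_ok hqv hvw.symm hok hHv
      · exact (hopen p (Finset.mem_of_mem_insert_of_ne hp h1)).congr
          fun x => (hHp p h1 h2 x).1

lemma GenPos.noColl {S : Finset Pt} (h : GenPos S) : NoColl S := by
  intro p hp q hq r hr hpq hpr hqr hc
  apply h p hp q hq r hr hpq hpr hqr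
  rw [collinear_iff_of_mem (p₀ := p) (by simp)]
  have hE : dt p q q ≠ 0 := by
    intro h0
    apply hpq
    unfold dt at h0
    have h1 : q 0 - p 0 = 0 := by nlinarith [sq_nonneg (q 0 - p 0), sq_nonneg (q 1 - p 1)]
    have h2 : q 1 - p 1 = 0 := by nlinarith [sq_nonneg (q 0 - p 0), sq_nonneg (q 1 - p 1)]
    ext i
    fin_cases i
    · simp only [Fin.zero_eta]; linarith
    · simp only [Fin.mk_one]; linarith
  refine ⟨q - p, fun x hx => ?_⟩
  simp only [Set.mem_insert_iff, Set.mem_singleton_iff] at hx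
  rcases hx with rfl | rfl | rfl
  · exact ⟨0, by simp⟩
  · exact ⟨1, by simp⟩
  · refine ⟨dt p q x / dt p q q, ?_⟩
    ext i
    have : ∀ i, dt p q q * (x i - p i) = dt p q x * (q i - p i) := by
      unfold cr at hc
      unfold dt
      intro i
      fin_cases i
      · simp only [Fin.zero_eta]; linear_combination (-(q 1 - p 1)) * hc
      · simp only [Fin.mk_one]; linear_combination (q 0 - p 0) * hc
    simp only [vadd_eq_add, PiLp.add_apply, PiLp.smul_apply, PiLp.sub_apply, smul_eq_mul]
    have := this i
    field_simp
    linarith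

/-- Every finite point set in general position with at least two points admits a
`5π/4`-open non-crossing Hamiltonian spanning path. -/
theorem stmt17 (S : Finset Pt) (hgp : GenPos S) (h2 : 2 ≤ S.card) :
    ∃ P : PSLG S, P.IsSpanningPath ∧ P.IsPhiOpen (5 * Real.pi / 4) := by
  obtain ⟨q, r, h⟩ := exists_openPath hgp.noColl h2
  obtain ⟨G, hG, ho, -⟩ := h.exists_pslg hgp.noColl
  exact ⟨G, hG, ho⟩
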